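/- Let β : ℝ → ℝ be continuous, B(t) = ∫₀ᵗ β(τ) dτ, and let Θ_uu, Θ_ul, Θ_un be real numbers with Θ_ul·Θ_un ≠ 0; set λ = √(Θ_ul² + Θ_un²) and y(t) = λ·B(t) + arctan(Θ_uu/λ). Let I ⊆ ℝ be an interval containing 0 with |y(t)| < π/2 for all t ∈ I. Define the symmetric 3×3 matrix family Θ(t) (indices u,l,n) with Θ(t)_uu = λ·tan(y(t)), Θ(t)_ul = Θ_ul, Θ(t)_un = Θ_un, Θ(t)_ll = −(Θ_ul²/λ)·tan(y(t)), Θ(t)_ln = −(Θ_ul·Θ_un/λ)·tan(y(t)), Θ(t)_nn = −(Θ_un²/λ)·tan(y(t)); and define U(t) by U(t)_uu = 1 − Θ_uu·B(t), U(t)_ul = −Θ_ul·B(t), U(t)_un = −Θ_un·B(t), U(t)_lu = (Θ_ul/λ)·(Θ_uu/λ − (1 − Θ_uu·B(t))·tan(y(t))), U(t)_ll = 1 + (Θ_ul²·B(t)/λ)·tan(y(t)), U(t)_ln = (Θ_ul·Θ_un·B(t)/λ)·tan(y(t)), U(t)_nu = (Θ_un/λ)·(Θ_uu/λ − (1 −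 Θ_uu·B(t))·tan(y(t))), U(t)_nl = (Θ_ul·Θ_un·B(t)/λ)·tan(y(t)), U(t)_nn = 1 + (Θ_un²·B(t)/λ)·tan(y(t)). Then U is the unique differentiable family of 3×3 real matrices on I satisfying U'(t) + β(t)·Θ(t)·U(t) = 0 with U(0) = Id. -/

import Mathlib

open Real Matrix

lemma eq_of_hasDerivWithinAt_zero {I : Set ℝ} (hI : I.OrdConnected) {f : ℝ → ℝ}
    (hf : ∀ t ∈ I, HasDerivWithinAt f 0 I t) {s t : ℝ} (hs : s ∈ I) (ht : t ∈ I) :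
    f t = f s := by
  have h := hI.convex.norm_image_sub_le_of_norm_hasDerivWithin_le (C := 0) hf
    (fun x _ => by simp) hs ht
  rw [zero_mul] at h
  exact sub_eq_zero.mp (norm_le_zero_iff.mp h)

/-- A column of a solution of `W' + β Θ W = 0` that vanishes at `0` vanishes identically.
With `d = (p b + q c) / l`, the quantities `q b - p c` and `T a + d` are conserved. -/
lemma column_eq_zero {I : Set ℝ} (hI : I.OrdConnected) (h0 : (0 : ℝ) ∈ I)
    {β T a b c : ℝ → ℝ} {l p q : ℝ} (hl : l ≠ 0) (hl2 : l ^ 2 = p ^ 2 + q ^ 2)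
    (hT : ∀ t ∈ I, HasDerivWithinAt T (l * β t * (1 + T t ^ 2)) I t)
    (ha : ∀ t ∈ I, HasDerivWithinAt a (-(β t * (l * T t * a t + p * b t + q * c t))) I t)
    (hb : ∀ t ∈ I, HasDerivWithinAt b
      (-(β t * (p * a t + -(p ^ 2 / l) * T t * b t + -(p * q / l) * T t * c t))) I t)
    (hc : ∀ t ∈ I, HasDerivWithinAt c
      (-(β t * (q * a t + -(p * q / l) * T t * b t + -(q ^ 2 / l) * T t * c t))) I t)
    (ha0 : a 0 = 0) (hb0 : b 0 = 0) (hc0 : c 0 = 0) :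
    ∀ t ∈ I, a t = 0 ∧ b t = 0 ∧ c t = 0 := by
  have he : ∀ t ∈ I, q * b t - p * c t = 0 := by
    intro t ht
    have h := eq_of_hasDerivWithinAt_zero hI (f := fun s => q * b s - p * c s)
      (fun s hs => by
        refine (((hb s hs).const_mul q).sub ((hc s hs).const_mul p)).congr_deriv ?_
        ring) h0 ht
    simpa [hb0, hc0] using h
  have hf : ∀ t ∈ I, l * (T t * a t) + (p * b t + q * c t) = 0 := by
    intro t ht
    have h := eq_of_hasDerivWithinAt_zero hI
      (f := fun s => l * (T s * a s) + (p * b s + q * c s))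
      (fun s hs => by
        refine ((((hT s hs).mul (ha s hs)).const_mul l).add
          (((hb s hs).const_mul p).add ((hc s hs).const_mul q))).congr_deriv ?_
        field_simp
        linear_combination (β s * (a s * l - T s * (p * b s + q * c s))) * hl2) h0 ht
    simpa [ha0, hb0, hc0] using h
  intro t ht
  have hat : a t = 0 := by
    have h := eq_of_hasDerivWithinAt_zero hI (f := a)
      (fun s hs => (ha s hs).congr_deriv (by linear_combination (-β s) * hf s hs)) h0 ht
    rwa [ha0] at h
  have hd := hf t ht
  have het := he t ht
  rw [hat] at hd
  refine ⟨hat, ?_, ?_⟩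
  · have : l ^ 2 * b t = 0 := by linear_combination b t * hl2 + p * hd + q * het
    exact (mul_eq_zero.mp this).resolve_left (pow_ne_zero 2 hl)
  · have : l ^ 2 * c t = 0 := by linear_combination c t * hl2 + q * hd - p * het
    exact (mul_eq_zero.mp this).resolve_left (pow_ne_zero 2 hl)

/-- Explicit solution of the coframe evolution equation `U' + β Θ U = 0` of the
left-invariant parallel spinor flow in the case `Θ_ul·Θ_un ≠ 0`;
`3×3` matrices are indexed by `Fin 3` with `0 = u`, `1 = l`, `2 = n`. -/
theorem stmt_9
    (β B : ℝ → ℝ) (hβ : Continuous β)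
    (hB : ∀ t, B t = ∫ τ in (0:ℝ)..t, β τ)
    (Θuu Θul Θun : ℝ) (hΘ : Θul * Θun ≠ 0)
    (lam : ℝ) (hlam : lam = Real.sqrt (Θul ^ 2 + Θun ^ 2))
    (y : ℝ → ℝ) (hy : ∀ t, y t = lam * B t + arctan (Θuu / lam))
    (I : Set ℝ) (hI : I.OrdConnected) (h0 : (0:ℝ) ∈ I)
    (hsmall : ∀ t ∈ I, |y t| < π / 2)
    (Θm U : ℝ → Matrix (Fin 3) (Fin 3) ℝ)
    (hΘm : ∀ t, Θm t =
      !![lam * tan (y t), Θul,                               Θun;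
         Θul,             -(Θul ^ 2 / lam) * tan (y t),      -(Θul * Θun / lam) * tan (y t);
         Θun,             -(Θul * Θun / lam) * tan (y t),    -(Θun ^ 2 / lam) * tan (y t)])
    (hU : ∀ t, U t =
      !![1 - Θuu * B t,
         -(Θul * B t),
         -(Θun * B t);
         (Θul / lam) * (Θuu / lam - (1 - Θuu * B t) * tan (y t)),
         1 + (Θul ^ 2 * B t / lam) * tan (y t),
         (Θul * Θun * B t / lam) * tan (y t);
         (Θun / lam) * (Θuu / lam - (1 - Θuu * B t) * tan (y t)),
         (Θul * Θun * B t / lam) * tan (y t),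
         1 + (Θun ^ 2 * B t / lam) * tan (y t)]) :
    -- U is differentiable and solves U' + β Θ U = 0 on I with U(0) = Id
    ((∀ t ∈ I, ∀ i j, HasDerivWithinAt (fun s => U s i j)
        (-(β t * (Θm t * U t) i j)) I t) ∧ U 0 = 1) ∧
    -- and it is the unique such family
    ∀ V : ℝ → Matrix (Fin 3) (Fin 3) ℝ,
      (∀ t ∈ I, ∀ i j, HasDerivWithinAt (fun s => V s i j)
        (-(β t * (Θm t * V t) i j)) I t) → V 0 = 1 →
      ∀ t ∈ I, V t = U t := by
  have hpos : 0 < Θul ^ 2 + Θun ^ 2 := by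
    have := left_ne_zero_of_mul hΘ
    positivity
  have hl : lam ≠ 0 := by
    rw [hlam]
    exact (Real.sqrt_pos.mpr hpos).ne'
  have hl2 : lam ^ 2 = Θul ^ 2 + Θun ^ 2 := by rw [hlam, Real.sq_sqrt hpos.le]
  have hBd : ∀ t, HasDerivAt B (β t) t := by
    intro t
    rw [funext hB]
    exact intervalIntegral.integral_hasDerivAt_right (hβ.intervalIntegrable _ _)
      (hβ.stronglyMeasurableAtFilter _ _) hβ.continuousAt
  have hB0 : B 0 = 0 := by simp [hB]
  have hTd : ∀ t ∈ I, HasDerivAt (fun s => tan (y s)) (lam * β t * (1 + tan (y t) ^ 2)) t := by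
    intro t ht
    have hcos : cos (y t) ≠ 0 := (cos_pos_of_mem_Ioo (abs_lt.mp (hsmall t ht))).ne'
    have hyd : HasDerivAt y (lam * β t) t := by
      rw [funext hy]
      exact ((hBd t).const_mul lam).add_const _
    refine ((hasDerivAt_tan hcos).comp t hyd).congr_deriv ?_
    rw [← inv_one_add_tan_sq hcos]
    field_simp
  have hT0 : tan (y 0) = Θuu / lam := by rw [hy, hB0, mul_zero, zero_add, tan_arctan]
  have hUd : ∀ t ∈ I, ∀ i j, HasDerivWithinAt (fun s => U s i j)
      (-(β t * (Θm t * U t) i j)) I t := by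
    intro t ht i j
    apply HasDerivAt.hasDerivWithinAt
    have hb := hBd t
    have hT := hTd t ht
    have hP := (hb.const_mul Θuu).const_sub 1
    have hX := (hP.mul hT).const_sub (Θuu / lam)
    simp only [hU, hΘm]
    generalize hTt : tan (y t) = T at *
    fin_cases i <;> fin_cases j <;>
      simp [Matrix.mul_apply, Fin.sum_univ_three]
    · refine hP.congr_deriv ?_
      field_simp
      linear_combination (β t * (lam * T - Θuu - Θuu * lam * T * B t)) * hl2
    · refine (hb.const_mul Θul).neg.congr_deriv ?_
      field_simp
      linear_combination (-(Θul * β t * T * B t)) * hl2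
    · refine (hb.const_mul Θun).neg.congr_deriv ?_
      field_simp
      linear_combination (-(Θun * β t * T * B t)) * hl2
    · refine (hX.const_mul (Θul / lam)).congr_deriv ?_
      field_simp
      linear_combination (Θul * β t * (Θuu * T + lam * Θuu * T ^ 2 * B t - lam * T ^ 2)) * hl2
    · refine (((hb.const_mul (Θul ^ 2)).div_const lam).mul hT).congr_deriv ?_
      rw [hTt]
      field_simp
      linear_combination (Θul ^ 2 * β t * B t * T ^ 2) * hl2
    · refine (((hb.const_mul (Θul * Θun)).div_const lam).mul hT).congr_deriv ?_
      rw [hTt]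
      field_simp
      linear_combination (Θul * Θun * β t * B t * T ^ 2) * hl2
    · refine (hX.const_mul (Θun / lam)).congr_deriv ?_
      field_simp
      linear_combination (Θun * β t * (Θuu * T + lam * Θuu * T ^ 2 * B t - lam * T ^ 2)) * hl2
    · refine (((hb.const_mul (Θul * Θun)).div_const lam).mul hT).congr_deriv ?_
      rw [hTt]
      field_simp
      linear_combination (Θul * Θun * β t * B t * T ^ 2) * hl2
    · refine (((hb.const_mul (Θun ^ 2)).div_const lam).mul hT).congr_deriv ?_
      rw [hTt]
      field_simp
      linear_combination (Θun ^ 2 * β t * B t * T ^ 2) * hl2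
  have hU0 : U 0 = 1 := by
    rw [hU, hT0, hB0]
    ext i j
    fin_cases i <;> fin_cases j <;> simp
  refine ⟨⟨hUd, hU0⟩, ?_⟩
  intro V hV hV0 t ht
  have key : ∀ j, V t 0 j - U t 0 j = 0 ∧ V t 1 j - U t 1 j = 0 ∧ V t 2 j - U t 2 j = 0 := by
    intro j
    refine column_eq_zero hI h0 hl hl2 (β := β) (T := fun s => tan (y s))
      (a := fun s => V s 0 j - U s 0 j) (b := fun s => V s 1 j - U s 1 j)
      (c := fun s => V s 2 j - U s 2 j) (fun s hs => (hTd s hs).hasDerivWithinAt)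
      ?_ ?_ ?_ (by simp [hV0, hU0]) (by simp [hV0, hU0]) (by simp [hV0, hU0]) t ht
    all_goals
      intro s hs
      refine ((hV s hs _ j).sub (hUd s hs _ j)).congr_deriv ?_
      simp only [Matrix.mul_apply, Fin.sum_univ_three, hΘm, Matrix.of_apply, Matrix.cons_val]
      ring
  ext i j
  obtain ⟨hu, hl, hn⟩ := key j
  fin_cases i
  · exact sub_eq_zero.mp hu
  · exact sub_eq_zero.mp hl
  · exact sub_eq_zero.mp hn
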